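/- For every m≥7, D((t_{m+1}+t_{m-1}−3)/2) = (m/44)(9t_m−12t_{m-1}−5t_{m-2}) + (3/11)(−2t_m+2t_{m-1}+t_{m-2}) + m/4. -/

import Mathlib

/-- The three-letter alphabet of the Tribonacci word. -/
inductive TLetter : Type
  | a | b | c
deriving DecidableEq

/-- The Tribonacci substitution σ(a)=ab, σ(b)=ac, σ(c)=a. -/
def tsubst : TLetter → List TLetter
  | .a => [.a, .b]
  | .b => [.a, .c]
  | .c => [.a]

/-- `Tword m = σ^m(a)`, the m-th finite Tribonacci word. -/
def Tword : ℕ → List TLetter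
  | 0 => [.a]
  | n + 1 => (Tword n).flatMap tsubst

/-- The prefix 𝕋[1,n] of the Tribonacci word of length n
(each `Tword n` is a prefix of the next and has length ≥ n). -/
def TPrefix (n : ℕ) : List TLetter := (Tword n).take n

/-- A word is a factor of the Tribonacci word 𝕋. -/
def IsFactorT (w : List TLetter) : Prop := ∃ m, w <:+: Tword m

/-- `tribAux i = t_{i-2}`: Tribonacci numbers, shifted so that the index is a natural. -/
def tribAux : ℕ → ℕ
  | 0 => 0
  | 1 => 1
  | 2 => 1
  | n + 3 => tribAux (n + 2) + tribAux (n + 1) + tribAux n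

/-- The Tribonacci numbers `t m` for `m : ℤ`: t₋₂=0, t₋₁=1, t₀=1,
`t m = t (m-1) + t (m-2) + t (m-3)` for m ≥ 1. (Junk value 0 below -2.) -/
def t (m : ℤ) : ℕ := tribAux (m + 2).toNat

/-- Kernel numbers: k₀=0, k₁=k₂=1, `k m = k (m-1) + k (m-2) + k (m-3) - 1` for m ≥ 3. -/
def kAux : ℕ → ℕ
  | 0 => 0
  | 1 => 1
  | 2 => 1
  | n + 3 => kAux (n + 2) + kAux (n + 1) + kAux n - 1

def kker (m : ℤ) : ℕ := kAux m.toNat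

/-- `A n`: the number of distinct nonempty words w with ww a factor of 𝕋[1,n]. -/
noncomputable def A (n : ℕ) : ℕ := Nat.card {w : List TLetter // w ≠ [] ∧ (w ++ w) <:+: TPrefix n}

/-- `B n`: the number of occurrences of squares in 𝕋[1,n], i.e. of pairs (w,i) with
w nonempty, i ≥ 1, ww occurring in 𝕋 at position i and i + 2|w| - 1 ≤ n. -/
noncomputable def B (n : ℕ) : ℕ :=
  Nat.card {p : List TLetter × ℕ // p.1 ≠ [] ∧ 1 ≤ p.2 ∧
    p.2 + 2 * p.1.length - 1 ≤ n ∧ (p.1 ++ p.1) <+: (TPrefix n).drop (p.2 - 1)}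

/-- `C n`: the number of distinct nonempty words w with www a factor of 𝕋[1,n]. -/
noncomputable def C (n : ℕ) : ℕ := Nat.card {w : List TLetter // w ≠ [] ∧ (w ++ w ++ w) <:+: TPrefix n}

/-- `D n`: the number of occurrences of cubes in 𝕋[1,n], i.e. of pairs (w,i) with
w nonempty, i ≥ 1, www occurring in 𝕋 at position i and i + 3|w| - 1 ≤ n. -/
noncomputable def D (n : ℕ) : ℕ :=
  Nat.card {p : List TLetter × ℕ // p.1 ≠ [] ∧ 1 ≤ p.2 ∧
    p.2 + 3 * p.1.length - 1 ≤ n ∧ (p.1 ++ p.1 ++ p.1) <+: (TPrefix n).drop (p.2 - 1)}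

namespace Tribonacci

/-- The letter at (zero-based) position `n` of the infinite Tribonacci word. -/
def letter (n : ℕ) : TLetter := (Tword n).getD n .a

/-- The factor of length `l` starting at (zero-based) position `s`. -/
def factor (s l : ℕ) : List TLetter := (List.range l).map fun r => letter (s + r)

/-- The length of the image under the substitution of the prefix of length `n`;
equivalently the position of the `n`-th letter `a`. -/
def pos : ℕ → ℕ
  | 0 => 0
  | n + 1 => pos n + (tsubst (letter n)).length

/-- The cyclic successor of a letter: the letter that follows the leading `a` of an image block. -/
def next : TLetter → TLetter
  | .a => .b
  | .b => .c
  | .c => .a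

lemma next_injective : Function.Injective next := by
  intro u v h
  cases u <;> cases v <;> simp_all [next]

lemma Tword_le_succ (n : ℕ) : Tword n <+: Tword (n + 1) := by
  induction n with
  | zero => exact ⟨[.b], rfl⟩
  | succ n ih =>
    obtain ⟨v, hv⟩ := ih
    exact ⟨v.flatMap tsubst, by
      rw [Tword, ← List.flatMap_append, hv, ← Tword]⟩

lemma Tword_le {m n : ℕ} (h : m ≤ n) : Tword m <+: Tword n := by
  induction n, h using Nat.le_induction with
  | base => exact List.prefix_rfl
  | succ n _ ih => exact ih.trans (Tword_le_succ n)

lemma lt_length_Tword (n : ℕ) : n < (Tword n).length := by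
  induction n with
  | zero => simp [Tword]
  | succ n ih =>
    obtain ⟨v, hv⟩ := Tword_le (Nat.zero_le n)
    have key : ∀ w : List TLetter, w.length ≤ (w.flatMap tsubst).length := by
      intro w
      induction w with
      | nil => simp
      | cons u w ihw =>
        rw [List.flatMap_cons, List.length_append, List.length_cons]
        cases u <;> simp only [tsubst, List.length_cons, List.length_nil] <;> omega
    have := key v
    rw [← hv] at ih
    rw [Tword, ← hv]
    simp only [Tword, List.flatMap_append, List.length_append, List.flatMap_cons, tsubst,
      List.flatMap_nil, List.length_cons, List.length_nil] at ih ⊢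
    omega

lemma getElem_Tword {m i : ℕ} (h : i < (Tword m).length) : (Tword m)[i] = letter i := by
  have hi := lt_length_Tword i
  rw [letter, List.getD_eq_getElem _ _ hi]
  rcases le_total m i with hm | hm
  · exact (Tword_le hm).getElem h
  · exact ((Tword_le hm).getElem hi).symm

@[simp] lemma length_factor (s l : ℕ) : (factor s l).length = l := by simp [factor]

lemma factor_add (s l k : ℕ) : factor s (l + k) = factor s l ++ factor (s + l) k := by
  simp [factor, List.range_add, Nat.add_assoc, Function.comp_def]

lemma factor_succ (s l : ℕ) : factor s (l + 1) = factor s l ++ [letter (s + l)] := by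
  simp [factor, List.range_succ]

lemma take_Tword {m n : ℕ} (h : n ≤ (Tword m).length) : (Tword m).take n = factor 0 n := by
  apply List.ext_getElem
  · simpa using h
  · intro i h1 h2
    rw [List.getElem_take, getElem_Tword]
    simp [factor]

lemma TPrefix_eq (n : ℕ) : TPrefix n = factor 0 n := take_Tword (lt_length_Tword n).le

lemma TPrefix_drop {n s : ℕ} (h : s ≤ n) : (TPrefix n).drop s = factor s (n - s) := by
  obtain ⟨k, rfl⟩ := Nat.exists_eq_add_of_le h
  rw [TPrefix_eq, factor_add, List.drop_append_of_le_length (by simp)]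
  simp

lemma factor_eq_iff {s s' l : ℕ} :
    factor s l = factor s' l ↔ ∀ r < l, letter (s + r) = letter (s' + r) := by
  simp [factor, List.map_inj_left]

lemma flatMap_factor (n : ℕ) : (factor 0 n).flatMap tsubst = factor 0 (pos n) := by
  have hlen : ((factor 0 n).flatMap tsubst).length = pos n := by
    induction n with
    | zero => simp [factor, pos]
    | succ n ih => simp [factor_succ, pos, ← ih]
  have hp : (factor 0 n).flatMap tsubst <+: Tword (n + 1) := by
    rw [← take_Tword (lt_length_Tword n).le]
    exact List.IsPrefix.flatMap ⟨_, List.take_append_drop _ _⟩ tsubst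
  rw [List.prefix_iff_eq_take] at hp
  rw [hlen] at hp
  rw [hp]
  apply take_Tword
  rw [hp, List.length_take] at hlen
  omega

lemma factor_pos (n : ℕ) : factor (pos n) (tsubst (letter n)).length = tsubst (letter n) := by
  have h := flatMap_factor (n + 1)
  rw [factor_succ, List.flatMap_append, flatMap_factor, pos, factor_add] at h
  simpa using (List.append_cancel_left h).symm

lemma pos_succ_a {n : ℕ} (h : letter n = .a) : pos (n + 1) = pos n + 2 := by
  simp [pos, h, tsubst]

lemma pos_succ_b {n : ℕ} (h : letter n = .b) : pos (n + 1) = pos n + 2 := by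
  simp [pos, h, tsubst]

lemma pos_succ_c {n : ℕ} (h : letter n = .c) : pos (n + 1) = pos n + 1 := by
  simp [pos, h, tsubst]

@[simp] lemma letter_pos (n : ℕ) : letter (pos n) = .a := by
  have h := factor_pos n
  cases hn : letter n <;> simp [hn, tsubst, factor, List.range_succ] at h <;> simp [h]

@[simp] lemma letter_pos_add_one (n : ℕ) : letter (pos n + 1) = next (letter n) := by
  have h := factor_pos n
  cases hn : letter n
  · simp [hn, tsubst, factor, List.range_succ] at h
    simp [h, next]
  · simp [hn, tsubst, factor, List.range_succ] at h
    simp [h, next]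
  · rw [← pos_succ_c hn, letter_pos, next]

lemma pos_lt_succ (n : ℕ) : pos n + 1 ≤ pos (n + 1) ∧ pos (n + 1) ≤ pos n + 2 := by
  cases h : letter n
  · rw [pos_succ_a h]; omega
  · rw [pos_succ_b h]; omega
  · rw [pos_succ_c h]; omega

lemma pos_strictMono : StrictMono pos :=
  strictMono_nat_of_lt_succ fun n => (pos_lt_succ n).1

lemma pos_add_le (i n : ℕ) : pos i + n ≤ pos (i + n) := by
  rw [Nat.add_comm i, Nat.add_comm (pos i)]
  exact pos_strictMono.add_le_nat n i

/-- Every position is the start of an image block or the second letter of a two-letter block. -/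
lemma exists_pos (s : ℕ) :
    ∃ i, s = pos i ∨ (s = pos i + 1 ∧ letter i ≠ .c) := by
  induction s with
  | zero => exact ⟨0, Or.inl rfl⟩
  | succ s ih =>
    obtain ⟨i, rfl | ⟨rfl, hi⟩⟩ := ih
    · cases h : letter i
      · exact ⟨i, Or.inr ⟨rfl, by simp [h]⟩⟩
      · exact ⟨i, Or.inr ⟨rfl, by simp [h]⟩⟩
      · exact ⟨i + 1, Or.inl (pos_succ_c h).symm⟩
    · refine ⟨i + 1, Or.inl ?_⟩
      cases h : letter i
      · rw [pos_succ_a h]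
      · rw [pos_succ_b h]
      · exact absurd h hi

lemma eq_pos_of_letter_eq_a {s : ℕ} (h : letter s = .a) : ∃ i, s = pos i := by
  obtain ⟨i, rfl | ⟨rfl, hi⟩⟩ := exists_pos s
  · exact ⟨i, rfl⟩
  · rw [letter_pos_add_one] at h
    cases h' : letter i <;> simp_all [next]

lemma eq_pos_add_one_of_letter_ne_a {s : ℕ} (h : letter s ≠ .a) :
    ∃ i, s = pos i + 1 ∧ s + 1 = pos (i + 1) := by
  obtain ⟨i, rfl | ⟨rfl, hi⟩⟩ := exists_pos s
  · simp at h
  · refine ⟨i, rfl, ?_⟩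
    cases h' : letter i
    · rw [pos_succ_a h']
    · rw [pos_succ_b h']
    · exact absurd h' hi

lemma letter_succ_of_letter_ne_a {s : ℕ} (h : letter s ≠ .a) : letter (s + 1) = .a := by
  obtain ⟨i, -, h⟩ := eq_pos_add_one_of_letter_ne_a h
  rw [h, letter_pos]

/-- Desubstitution of a repetition of period `p` whose matches fill `[s, f)`. -/
lemma exists_preimage_repetition {p s f : ℕ} (hp : 1 ≤ p) (hsf : s < f)
    (h : ∀ i, s ≤ i → i < f → letter i = letter (i + p)) :
    ∃ i q g, 1 ≤ q ∧ i ≤ g ∧ (∀ j, i ≤ j → j < g → letter j = letter (j + q)) ∧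
      pos i ≤ s ∧ f ≤ pos g + 1 ∧ pos (i + q) = pos i + p ∧ pos (g + q) = pos g + p := by
  induction f, hsf using Nat.le_induction with
  | base =>
    have hs := h s le_rfl (Nat.lt_succ_self s)
    by_cases ha : letter s = .a
    · obtain ⟨i, hi⟩ := eq_pos_of_letter_eq_a ha
      obtain ⟨k, hk⟩ := eq_pos_of_letter_eq_a (hs ▸ ha)
      have hik : i < k := pos_strictMono.lt_iff_lt.1 (by omega)
      obtain ⟨q, rfl⟩ := Nat.exists_eq_add_of_lt hik
      refine ⟨i, q + 1, i, by omega, le_rfl, fun j h1 h2 => by omega, by omega, by omega, ?_, ?_⟩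
        <;> rw [← Nat.add_assoc] <;> omega
    · obtain ⟨i, hi, hi'⟩ := eq_pos_add_one_of_letter_ne_a ha
      obtain ⟨k, hk, hk'⟩ := eq_pos_add_one_of_letter_ne_a (hs ▸ ha)
      have hik : i < k := pos_strictMono.lt_iff_lt.1 (by omega)
      obtain ⟨q, rfl⟩ := Nat.exists_eq_add_of_lt hik
      refine ⟨i, q + 1, i + 1, by omega, by omega, fun j h1 h2 => ?_, by omega, by omega, ?_, ?_⟩
      · obtain rfl : j = i := by omega
        rw [hk, hi, letter_pos_add_one, letter_pos_add_one] at hs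
        exact next_injective hs
      · rw [← Nat.add_assoc]; omega
      · rw [show i + 1 + (q + 1) = i + q + 1 + 1 by ring]; omega
  | succ f hf ih =>
    obtain ⟨i, q, g, hq, hig, hE, h1, h2, h3, h4⟩ := ih fun j hj hj' => h j hj (by omega)
    by_cases hfg : f + 1 ≤ pos g + 1
    · exact ⟨i, q, g, hq, hig, hE, h1, hfg, h3, h4⟩
    · obtain rfl : f = pos g + 1 := by omega
      have hl := h (pos g + 1) (by omega) (by omega)
      rw [show pos g + 1 + p = pos (g + q) + 1 by omega, letter_pos_add_one,
        letter_pos_add_one] at hl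
      have hl := next_injective hl
      refine ⟨i, q, g + 1, hq, by omega, fun j hj hj' => ?_, h1, ?_, h3, ?_⟩
      · rcases Nat.lt_succ_iff_lt_or_eq.1 hj' with hj' | rfl
        · exact hE j hj hj'
        · exact hl
      · have := (pos_lt_succ g).1
        omega
      · rw [show g + 1 + q = g + q + 1 by ring, pos, pos, ← hl]
        omega

/-- The length of the palindromic prefix obtained by iterating `w ↦ σ(w)a` on the empty word. -/
def palLength : ℕ → ℕ
  | 0 => 0
  | m + 1 => pos (palLength m) + 1

lemma pos_add {y l : ℕ} (h : ∀ r < l, letter (y + r) = letter r) :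
    ∀ r ≤ l, pos (y + r) = pos y + pos r := by
  intro r
  induction r with
  | zero => simp [pos]
  | succ r ih =>
    intro hr
    rw [← Nat.add_assoc, pos, pos, h r (by omega), ih (by omega)]
    omega

lemma letter_iterate_pos_add (j i : ℕ) :
    ∀ r < palLength j, letter (pos^[j] i + r) = letter r := by
  induction j with
  | zero => simp [palLength]
  | succ j ih =>
    intro r hr
    rw [Function.iterate_succ_apply']
    have hadd := pos_add ih
    rw [palLength] at hr
    obtain ⟨q, rfl | ⟨rfl, hq⟩⟩ := exists_pos r
    · have hq : q ≤ palLength j := pos_strictMono.le_iff_le.1 (by omega)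
      rw [← hadd q hq]
      simp
    · have hq : q < palLength j := pos_strictMono.lt_iff_lt.1 (by omega)
      rw [← Nat.add_assoc, ← hadd q hq.le, letter_pos_add_one, letter_pos_add_one, ih q hq]

lemma pos_iterate_add (j i : ℕ) {r : ℕ} (hr : r ≤ palLength j) :
    pos (pos^[j] i + r) = pos^[j + 1] i + pos r := by
  rw [Function.iterate_succ_apply']
  exact pos_add (letter_iterate_pos_add j i) r hr

/-- Full desubstitution of a repetition. -/
lemma exists_iterate_preimage {p s f : ℕ} (hp : 1 ≤ p) (hsf : s ≤ f)
    (h : ∀ i, s ≤ i → i < f → letter i = letter (i + p)) :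
    ∃ j i q, 1 ≤ q ∧ pos^[j] (i + q) = pos^[j] i + p ∧ pos^[j] i ≤ s ∧
      f ≤ pos^[j] i + palLength j := by
  induction p using Nat.strong_induction_on generalizing s f with
  | _ p ih =>
  rcases hsf.eq_or_lt with rfl | hsf
  · exact ⟨0, s, p, hp, rfl, le_rfl, le_rfl⟩
  obtain ⟨i, q, g, hq, hig, hE, h1, h2, h3, h4⟩ := exists_preimage_repetition hp hsf h
  have lift : (∃ j i' q', 1 ≤ q' ∧ pos^[j] (i' + q') = pos^[j] i' + q ∧ pos^[j] i' ≤ i ∧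
      g ≤ pos^[j] i' + palLength j) → ∃ j i q, 1 ≤ q ∧ pos^[j] (i + q) = pos^[j] i + p ∧
      pos^[j] i ≤ s ∧ f ≤ pos^[j] i + palLength j := by
    rintro ⟨j, i', q', hq', e1, e2, e3⟩
    refine ⟨j + 1, i', q', hq', ?_, ?_, ?_⟩
    · obtain ⟨r, rfl⟩ := Nat.exists_eq_add_of_le e2
      have hr : r ≤ palLength j := by omega
      have e4 := pos_iterate_add j i' hr
      have e5 := pos_iterate_add j (i' + q') hr
      rw [e1] at e5
      rw [show pos^[j] i' + r + q = pos^[j] i' + q + r by ring] at h3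
      omega
    · rw [Function.iterate_succ_apply']
      exact (pos_strictMono.monotone e2).trans h1
    · have := pos_strictMono.monotone e3
      rw [pos_iterate_add j i' le_rfl] at this
      rw [palLength]
      omega
  rcases (show q ≤ p by have := pos_add_le i q; omega).lt_or_eq with hlt | rfl
  · exact lift (ih q hlt hq hig hE)
  rcases hig.eq_or_lt with rfl | hig
  · exact lift ⟨0, i, q, hq, rfl, le_rfl, le_rfl⟩
  exfalso
  have hc : ∀ n < q, letter (i + n) = .c := fun n hn => by
    have e1 := pos_add_le i n
    have e2 := pos_add_le (i + (n + 1)) (q - (n + 1))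
    rw [show i + (n + 1) + (q - (n + 1)) = i + q by omega, ← Nat.add_assoc] at e2
    cases h : letter (i + n)
    · rw [pos_succ_a h] at e2
      omega
    · rw [pos_succ_b h] at e2
      omega
    · rfl
  have h0 := hc 0 hq
  have h1 : letter (i + 1) = .c := by
    rcases hq.eq_or_lt with rfl | hq
    · rw [← hE i le_rfl hig, ← h0, Nat.add_zero]
    · exact hc 1 hq
  have := letter_succ_of_letter_ne_a (s := i) (by rw [Nat.add_zero] at h0; simp [h0])
  simp [h1] at this

lemma tribAux_add_three (j : ℕ) :
    tribAux (j + 3) = tribAux (j + 2) + tribAux (j + 1) + tribAux j := rfl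

lemma iterate_pos_succ (j i : ℕ) :
    (letter i = .a → pos^[j] (i + 1) = pos^[j] i + tribAux (j + 2)) ∧
    (letter i = .b → pos^[j] (i + 1) = pos^[j] i + (tribAux (j + 1) + tribAux j)) ∧
    (letter i = .c → pos^[j] (i + 1) = pos^[j] i + tribAux (j + 1)) := by
  induction j generalizing i with
  | zero => simp [tribAux]
  | succ j ih =>
    simp only [Function.iterate_succ_apply]
    have h1 := (ih (pos i)).1 (letter_pos i)
    have h2 := ih (pos i + 1)
    refine ⟨fun h => ?_, fun h => ?_, fun h => ?_⟩
    · rw [pos_succ_a h, h2.2.1 (by simp [h, next]), h1, show j + 1 + 2 = j + 3 from rfl,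
        tribAux_add_three]
      omega
    · rw [pos_succ_b h, h2.2.2 (by simp [h, next]), h1, Nat.add_assoc]
    · rw [pos_succ_c h, h1]

lemma iterate_pos_strictMono (j : ℕ) : StrictMono pos^[j] := pos_strictMono.iterate j

lemma iterate_pos_zero (j : ℕ) : pos^[j] 0 = 0 := Function.iterate_fixed rfl j

@[simp] lemma letter_zero : letter 0 = .a := rfl

@[simp] lemma pos_zero : pos 0 = 0 := rfl

@[simp] lemma palLength_zero : palLength 0 = 0 := rfl

lemma palLength_add (k j : ℕ) : palLength (k + j) = pos^[k] (palLength j) + palLength k := by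
  induction k with
  | zero => simp [palLength]
  | succ k ih =>
    rw [show k + 1 + j = k + j + 1 by ring, palLength, ih, pos_iterate_add k _ le_rfl, palLength]
    omega

lemma palLength_succ (j : ℕ) : palLength (j + 1) = palLength j + tribAux (j + 2) := by
  have h := (iterate_pos_succ j 0).1 letter_zero
  rw [palLength_add, show palLength 1 = 0 + 1 from rfl, h, iterate_pos_zero]
  omega

lemma palLength_mono : Monotone palLength :=
  monotone_nat_of_le_succ fun n => by rw [palLength_succ]; omega

lemma two_mul_palLength (j : ℕ) :
    2 * palLength j + 3 = tribAux (j + 3) + tribAux (j + 1) := by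
  induction j with
  | zero => simp [palLength, tribAux]
  | succ j ih =>
    rw [palLength_succ, show j + 1 + 3 = (j + 1) + 3 from rfl, tribAux,
      show j + 1 + 2 = j + 3 by ring, show j + 1 + 1 = j + 2 by ring]
    omega

lemma tribAux_le_succ (j : ℕ) : tribAux j ≤ tribAux (j + 1) := by
  induction j using Nat.strong_induction_on with
  | _ j ih =>
    match j with
    | 0 => simp [tribAux]
    | 1 => simp [tribAux]
    | j + 2 => rw [tribAux_add_three j]; omega

lemma tribAux_pos (j : ℕ) : 0 < tribAux (j + 1) := by
  induction j with
  | zero => simp [tribAux]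
  | succ j ih => exact ih.trans_le (tribAux_le_succ _)

lemma tribAux_strictMono : StrictMono fun j => tribAux (j + 2) := by
  refine strictMono_nat_of_lt_succ fun j => ?_
  have := tribAux_pos j
  have := tribAux_pos (j + 1)
  rw [show j + 1 + 2 = j + 3 by ring, tribAux]
  have h : 0 < tribAux (j + 1) := tribAux_pos j
  omega

lemma palLength_lt (j : ℕ) : palLength j < 2 * tribAux (j + 2) := by
  have h := two_mul_palLength j
  rw [tribAux] at h
  have := tribAux_le_succ j
  have := tribAux_le_succ (j + 1)
  simp only [Nat.add_assoc, Nat.reduceAdd] at *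
  omega

/-- The number of letters `c` in the palindromic prefix of index `j`. -/
def numC (j : ℕ) : ℕ := Nat.count (fun i => letter i = .c) (palLength j)

lemma count_pos (n : ℕ) :
    Nat.count (fun i => letter i = .a) (pos n) = n ∧
    Nat.count (fun i => letter i = .b) (pos n) = Nat.count (fun i => letter i = .a) n ∧
    Nat.count (fun i => letter i = .c) (pos n) = Nat.count (fun i => letter i = .b) n := by
  induction n with
  | zero => simp [pos]
  | succ n ih =>
    obtain ⟨h1, h2, h3⟩ := ih
    cases h : letter n
    · simp [pos_succ_a h, Nat.count_succ, h, next, h1, h2, h3]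
    · simp [pos_succ_b h, Nat.count_succ, h, next, h1, h2, h3]
    · simp [pos_succ_c h, Nat.count_succ, h, h1, h2, h3]

lemma numC_add_three (j : ℕ) : numC (j + 3) = palLength j + 1 := by
  simp [numC, palLength, Nat.count_succ, count_pos]

lemma numC_eq_zero {j : ℕ} (hj : j < 3) : numC j = 0 := by
  interval_cases j <;> simp [numC, palLength, Nat.count_succ, count_pos]

lemma numC_add (k : ℕ) : numC k + 2 * tribAux (k + 2) = palLength (k + 1) + 1 := by
  rcases lt_or_ge k 3 with hk | hk
  · rw [numC_eq_zero hk]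
    interval_cases k <;> simp [palLength_succ, tribAux]
  · obtain ⟨j, rfl⟩ := Nat.exists_eq_add_of_le' hk
    rw [numC_add_three, palLength_succ, palLength_succ, palLength_succ, palLength_succ,
      tribAux_add_three (j + 2)]
    simp only [Nat.add_assoc, Nat.reduceAdd]
    omega

lemma numC_le (k : ℕ) : numC k ≤ tribAux (k + 2) := by
  have h1 := numC_add k
  have h2 := palLength_lt k
  have h3 := palLength_succ k
  omega

/-- Classification of the cubes of the Tribonacci word by period and starting position. -/
lemma cube_iff {p s : ℕ} (hp : 1 ≤ p) :
    (∀ i, s ≤ i → i < s + 2 * p → letter i = letter (i + p)) ↔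
    ∃ k i r, letter i = .c ∧ r < numC k ∧ p = tribAux (k + 2) ∧ s = pos^[k + 1] i + r := by
  constructor
  · intro h
    obtain ⟨j, i, q, hq, h1, h2, h3⟩ := exists_iterate_preimage hp (by omega) h
    have hpal := two_mul_palLength j
    have hlt := palLength_lt j
    have m0 := tribAux_le_succ j
    have m1 := tribAux_le_succ (j + 1)
    have hT : tribAux (j + 3) = tribAux (j + 2) + tribAux (j + 1) + tribAux j := tribAux_add_three j
    have hT' : tribAux (j + 2) ≤ 2 * tribAux (j + 1) + tribAux j := by
      rcases j with _ | j
      · simp [tribAux]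
      · have := tribAux_add_three j
        have := tribAux_le_succ j
        have := tribAux_le_succ (j + 1)
        simp only [Nat.add_assoc, Nat.reduceAdd] at *
        omega
    have hle : pos^[j] (i + 1) ≤ pos^[j] (i + q) := (iterate_pos_strictMono j).monotone (by omega)
    obtain ⟨ha, hb, hc⟩ := iterate_pos_succ j i
    cases h' : letter i
    · have := ha h'
      omega
    · have := hb h'
      omega
    · have hc := hc h'
      rcases hq.eq_or_lt with rfl | hq
      · rcases j with _ | k
        · simp only [Function.iterate_zero, id_eq, palLength_zero] at h2 h3
          omega
        · have := numC_add k
          simp only [Nat.add_assoc, Nat.reduceAdd] at *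
          exact ⟨k, i, s - pos^[k + 1] i, h', by omega, by omega, by omega⟩
      · have hnext := letter_succ_of_letter_ne_a (s := i) (by simp [h'])
        have := (iterate_pos_succ j (i + 1)).1 hnext
        have : pos^[j] (i + 1 + 1) ≤ pos^[j] (i + q) :=
          (iterate_pos_strictMono j).monotone (by omega)
        omega
  · rintro ⟨k, i, r, hi, hr, rfl, rfl⟩ l h1 h2
    obtain ⟨l, rfl⟩ := Nat.exists_eq_add_of_le (show pos^[k + 1] i ≤ l by omega)
    have := numC_add k
    have e := (iterate_pos_succ (k + 1) i).2.2 hi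
    rw [show pos^[k + 1] i + l + tribAux (k + 2) = pos^[k + 1] (i + 1) + l by
      rw [e]; simp only [Nat.add_assoc, Nat.reduceAdd]; omega]
    rw [letter_iterate_pos_add _ _ _ (by omega), letter_iterate_pos_add _ _ _ (by omega)]

lemma cube_end_le_iff {m k i r : ℕ} (hi : letter i = .c) (hr : r < numC k) :
    pos^[k + 1] i + r + 3 * tribAux (k + 2) ≤ palLength m ↔
      k < m ∧ i < palLength (m - 1 - k) := by
  have h1 := numC_add k
  have h2 := numC_le k
  have e := (iterate_pos_succ (k + 1) i).2.2 hi
  rw [show k + 1 + 1 = k + 2 by ring] at e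
  rcases lt_or_ge k m with hk | hk
  · obtain ⟨j, rfl⟩ := Nat.exists_eq_add_of_le (show k + 1 ≤ m from hk)
    rw [show k + 1 + j - 1 - k = j by omega, palLength_add]
    constructor
    · intro h
      refine ⟨hk, ?_⟩
      by_contra! hij
      have := (iterate_pos_strictMono (k + 1)).monotone hij
      omega
    · rintro ⟨-, hij⟩
      have := (iterate_pos_strictMono (k + 1)).monotone (show i + 1 ≤ palLength j from hij)
      omega
  · have := palLength_mono (show m ≤ k + 1 by omega)
    constructor
    · intro h
      omega
    · rintro ⟨h, -⟩
      omega

lemma cube_prefix_iff {n s : ℕ} {w : List TLetter} (h : s + 3 * w.length ≤ n) :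
    w ++ w ++ w <+: (TPrefix n).drop s ↔ w = factor s w.length ∧
      ∀ i, s ≤ i → i < s + 2 * w.length → letter i = letter (i + w.length) := by
  have hn : n - s = w.length + w.length + w.length + (n - s - 3 * w.length) := by omega
  rw [TPrefix_drop (by omega), List.prefix_iff_eq_take, hn, factor_add,
    List.take_append_of_le_length (by simp [Nat.add_assoc]),
    List.take_of_length_le (by simp [Nat.add_assoc]), factor_add, factor_add, ← Nat.add_assoc]
  constructor
  · intro h
    obtain ⟨h12, h3⟩ := List.append_inj h (by simp)
    obtain ⟨h1, h2⟩ := List.append_inj h12 (by simp)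
    refine ⟨h1, fun i hi hi' => ?_⟩
    have h12 := factor_eq_iff.1 (h1.symm.trans h2)
    have h23 := factor_eq_iff.1 (h2.symm.trans h3)
    obtain ⟨r, rfl⟩ := Nat.exists_eq_add_of_le hi
    rcases lt_or_ge r w.length with hr | hr
    · rw [h12 r hr]
      congr 1
      omega
    · obtain ⟨r, rfl⟩ := Nat.exists_eq_add_of_le hr
      rw [← Nat.add_assoc, h23 r (by omega)]
      congr 1
      omega
  · rintro ⟨hw, hE⟩
    have h12 : factor s w.length = factor (s + w.length) w.length :=
      factor_eq_iff.2 fun r hr => by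
        rw [hE _ (by omega) (by omega)]
        congr 1
        omega
    have h23 : factor (s + w.length) w.length = factor (s + w.length + w.length) w.length :=
      factor_eq_iff.2 fun r hr => by
        rw [hE _ (by omega) (by omega)]
        congr 1
        omega
    rw [← h23, ← h12, ← hw]

lemma D_palLength (m : ℕ) :
    D (palLength m) = ∑ k ∈ Finset.range m, numC (m - 1 - k) * numC k := by
  classical
  let S : Finset (Σ _ : ℕ, ℕ × ℕ) := (Finset.range m).sigma fun k =>
    {i ∈ Finset.range (palLength (m - 1 - k)) | letter i = .c} ×ˢ Finset.range (numC k)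
  have hS : S.card = ∑ k ∈ Finset.range m, numC (m - 1 - k) * numC k := by
    simp only [S, Finset.card_sigma, Finset.card_product, Finset.card_range, numC,
      Nat.count_eq_card_filter_range]
  have memS : ∀ z : Σ _ : ℕ, ℕ × ℕ, z ∈ S ↔
      (z.1 < m ∧ z.2.1 < palLength (m - 1 - z.1)) ∧ letter z.2.1 = .c ∧ z.2.2 < numC z.1 := by
    rintro ⟨k, i, r⟩
    simp only [S, Finset.mem_sigma, Finset.mem_product, Finset.mem_filter, Finset.mem_range]
    tauto
  rw [← hS, ← Nat.card_eq_finsetCard, D]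
  symm
  let f : (Σ _ : ℕ, ℕ × ℕ) → List TLetter × ℕ := fun z =>
    (factor (pos^[z.1 + 1] z.2.1 + z.2.2) (tribAux (z.1 + 2)), pos^[z.1 + 1] z.2.1 + z.2.2 + 1)
  have hmaps : Set.BijOn f S {p : List TLetter × ℕ | p.1 ≠ [] ∧ 1 ≤ p.2 ∧
      p.2 + 3 * p.1.length - 1 ≤ palLength m ∧
      (p.1 ++ p.1 ++ p.1) <+: (TPrefix (palLength m)).drop (p.2 - 1)} := by
    refine ⟨?_, ?_, ?_⟩
    · rintro ⟨k, i, r⟩ hz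
      obtain ⟨hm, hi, hr⟩ := (memS _).1 hz
      have hend := (cube_end_le_iff hi hr).2 hm
      have hp := tribAux_pos (k + 1)
      refine ⟨?_, Nat.le_add_left 1 _, ?_, ?_⟩
      · rw [← List.length_pos_iff]
        simpa [f] using hp
      · simp only [f, length_factor]
        simp only at hend
        omega
      · simp only [f, Nat.add_sub_cancel]
        rw [cube_prefix_iff (by simpa using hend)]
        simp only [length_factor, true_and]
        exact (cube_iff hp).2 ⟨k, i, r, hi, hr, rfl, rfl⟩
    · rintro ⟨k, i, r⟩ hz ⟨k', i', r'⟩ hz' h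
      obtain ⟨-, hi, hr⟩ := (memS _).1 hz
      obtain ⟨-, hi', hr'⟩ := (memS _).1 hz'
      simp only [f, Prod.mk.injEq] at h hi hr hi' hr'
      obtain rfl : k = k' := tribAux_strictMono.injective (by simpa using congrArg List.length h.1)
      have h2 := numC_le k
      have e := (iterate_pos_succ (k + 1) i).2.2 hi
      have e' := (iterate_pos_succ (k + 1) i').2.2 hi'
      rw [show k + 1 + 1 = k + 2 by ring] at e e'
      have hs := h.2
      rcases lt_trichotomy i i' with hlt | rfl | hlt
      · have := (iterate_pos_strictMono (k + 1)).monotone (show i + 1 ≤ i' from hlt)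
        omega
      · obtain rfl : r = r' := by omega
        rfl
      · have := (iterate_pos_strictMono (k + 1)).monotone (show i' + 1 ≤ i from hlt)
        omega
    · rintro ⟨w, s⟩ ⟨hw, hs, hend, hpre⟩
      simp only at hw hs hend hpre
      obtain ⟨s, rfl⟩ := Nat.exists_eq_add_of_le' hs
      rw [Nat.add_sub_cancel, cube_prefix_iff (by omega)] at hpre
      obtain ⟨k, i, r, hi, hr, hp, rfl⟩ := (cube_iff (List.length_pos_iff.2 hw)).1 hpre.2
      refine ⟨⟨k, i, r⟩, (memS _).2 ⟨(cube_end_le_iff hi hr).1 (by omega), hi, hr⟩, ?_⟩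
      simp only [f, Prod.mk.injEq, and_true]
      rw [← hp]
      exact hpre.1.symm
  exact Nat.card_congr hmaps.equiv

lemma numC_recurrence (j : ℕ) : numC (j + 3) = numC (j + 2) + numC (j + 1) + numC j + 1 := by
  have h0 := numC_add j
  have h1 := numC_add (j + 1)
  have h2 := numC_add (j + 2)
  have h3 := numC_add (j + 3)
  have e1 := palLength_succ (j + 1)
  have e2 := palLength_succ (j + 2)
  have e3 := palLength_succ (j + 3)
  have t2 := tribAux_add_three (j + 1)
  have t3 := tribAux_add_three (j + 2)
  have p1 := two_mul_palLength (j + 1)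
  simp only [Nat.add_assoc, Nat.reduceAdd] at *
  omega

lemma two_mul_numC (j : ℕ) :
    2 * (numC j : ℚ) = tribAux j + 2 * tribAux (j + 1) - tribAux (j + 2) - 1 := by
  have h1 := numC_add j
  have h2 := two_mul_palLength (j + 1)
  have h3 := tribAux_add_three j
  have h4 := tribAux_add_three (j + 1)
  simp only [Nat.add_assoc, Nat.reduceAdd] at *
  zify at *
  have : 2 * (numC j : ℤ) = tribAux j + 2 * tribAux (j + 1) - tribAux (j + 2) - 1 := by
    linarith
  exact_mod_cast this

lemma sum_numC (m : ℕ) :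
    2 * ((∑ k ∈ Finset.range m, numC k : ℕ) : ℚ) = tribAux (m + 2) - tribAux (m + 1) - m := by
  induction m with
  | zero => simp [tribAux]
  | succ m ih =>
    rw [Finset.sum_range_succ]
    push_cast at ih ⊢
    rw [mul_add, ih, two_mul_numC, show m + 1 + 2 = m + 3 from rfl, tribAux_add_three]
    push_cast
    ring

lemma numC_convolution_recurrence (m : ℕ) :
    ∑ k ∈ Finset.range (m + 3), numC (m + 3 - 1 - k) * numC k =
      ∑ k ∈ Finset.range (m + 2), numC (m + 2 - 1 - k) * numC k +
      ∑ k ∈ Finset.range (m + 1), numC (m + 1 - 1 - k) * numC k +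
      ∑ k ∈ Finset.range m, numC (m - 1 - k) * numC k + ∑ k ∈ Finset.range m, numC k := by
  have z0 : numC 0 = 0 := numC_eq_zero (by norm_num)
  have z1 : numC 1 = 0 := numC_eq_zero (by norm_num)
  have z2 : numC 2 = 0 := numC_eq_zero (by norm_num)
  rw [Finset.sum_range_succ _ (m + 2), Finset.sum_range_succ _ (m + 1), Finset.sum_range_succ _ m,
    Finset.sum_range_succ _ (m + 1), Finset.sum_range_succ _ m, Finset.sum_range_succ _ m]
  rw [show m + 3 - 1 - (m + 2) = 0 by omega, show m + 3 - 1 - (m + 1) = 1 by omega,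
    show m + 3 - 1 - m = 2 by omega, show m + 2 - 1 - (m + 1) = 0 by omega,
    show m + 2 - 1 - m = 1 by omega, show m + 1 - 1 - m = 0 by omega]
  simp only [z0, z1, z2, zero_mul, add_zero, ← Finset.sum_add_distrib]
  refine Finset.sum_congr rfl fun k hk => ?_
  obtain ⟨j, rfl⟩ := Nat.exists_eq_add_of_lt (Finset.mem_range.1 hk)
  rw [show k + j + 1 + 3 - 1 - k = j + 3 by omega, show k + j + 1 + 2 - 1 - k = j + 2 by omega,
    show k + j + 1 + 1 - 1 - k = j + 1 by omega, show k + j + 1 - 1 - k = j by omega,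
    numC_recurrence]
  ring

lemma numC_convolution (m : ℕ) :
    ((∑ k ∈ Finset.range m, numC (m - 1 - k) * numC k : ℕ) : ℚ) =
      (m : ℚ) / 44 * (9 * tribAux (m + 2) - 12 * tribAux (m + 1) - 5 * tribAux m) +
      3 / 11 * (-2 * tribAux (m + 2) + 2 * tribAux (m + 1) + tribAux m) + (m : ℚ) / 4 := by
  induction m using Nat.strong_induction_on with
  | _ m ih =>
  match m with
  | 0 => simp [tribAux]
  | 1 =>
    simp [numC_eq_zero, tribAux]
    norm_num
  | 2 =>
    simp [Finset.sum_range_succ, numC_eq_zero, tribAux]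
    norm_num
  | m + 3 =>
    rw [numC_convolution_recurrence, Nat.cast_add, Nat.cast_add, Nat.cast_add,
      ih m (by omega), ih (m + 1) (by omega), ih (m + 2) (by omega)]
    have hU := sum_numC m
    have t0 := tribAux_add_three m
    have t1 := tribAux_add_three (m + 1)
    have t2 := tribAux_add_three (m + 2)
    simp only [Nat.add_assoc, Nat.reduceAdd] at *
    rw [t2, t1, t0]
    push_cast at hU ⊢
    linear_combination hU / 2

end Tribonacci

theorem repeated_cubes_at_block_end (m : ℤ) (hm : 7 ≤ m) :
    (D ((t (m + 1) + t (m - 1) - 3) / 2) : ℚ) =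
      (m : ℚ) / 44 * (9 * (t m : ℚ) - 12 * (t (m - 1) : ℚ) - 5 * (t (m - 2) : ℚ)) +
      3 / 11 * (-2 * (t m : ℚ) + 2 * (t (m - 1) : ℚ) + (t (m - 2) : ℚ)) +
      (m : ℚ) / 4 := by
  obtain ⟨n, rfl⟩ := Int.eq_ofNat_of_zero_le (show 0 ≤ m by omega)
  have e1 : t ((n : ℤ) + 1) = tribAux (n + 3) := by rw [t]; congr 1
  have e0 : t (n : ℤ) = tribAux (n + 2) := by rw [t]; congr 1
  have e2 : t ((n : ℤ) - 1) = tribAux (n + 1) := by rw [t]; congr 1; omega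
  have e3 : t ((n : ℤ) - 2) = tribAux n := by rw [t]; congr 1; omega
  have hpal := Tribonacci.two_mul_palLength n
  rw [e0, e1, e2, e3, show (tribAux (n + 3) + tribAux (n + 1) - 3) / 2 = Tribonacci.palLength n by
    omega, Tribonacci.D_palLength, Tribonacci.numC_convolution]
  push_cast
  rfl
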